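/- A finite simple graph G is a proper central-max-point tolerance graph (PCMPTG) if and only if G is a proper interval graph. -/

import Mathlib

variable {V : Type*}

/-- An MPT representation of a simple graph: each vertex `u` gets an interval
`[a u, b u]` with a point `p u` inside it, and distinct vertices `u, v` are adjacent
iff both `p u` and `p v` lie in the intersection of the two intervals. -/
def IsMPTRep (G : SimpleGraph V) (a b p : V → ℝ) : Prop :=
  (∀ u, a u ≤ b u) ∧ (∀ u, p u ∈ Set.Icc (a u) (b u)) ∧
    ∀ u v : V, u ≠ v →
      (G.Adj u v ↔ p u ∈ Set.Icc (a u) (b u) ∩ Set.Icc (a v) (b v) ∧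
                   p v ∈ Set.Icc (a u) (b u) ∩ Set.Icc (a v) (b v))

/-- A central-max-point tolerance graph: an MPT representation where every point is
the center of its interval. -/
def IsCMPTG (G : SimpleGraph V) : Prop :=
  ∃ a b : V → ℝ, IsMPTRep G a b (fun u => (a u + b u) / 2)

/-- A proper interval graph: each vertex gets a closed real interval, distinct vertices
are adjacent iff their intervals intersect, and no interval properly contains another. -/
def IsProperIntervalGraph (G : SimpleGraph V) : Prop :=
  ∃ a b : V → ℝ, (∀ u, a u ≤ b u) ∧
    (∀ u v : V, u ≠ v →
      (G.Adj u v ↔ (Set.Icc (a u) (b u) ∩ Set.Icc (a v) (b v)).Nonempty)) ∧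
    ∀ u v : V, u ≠ v → ¬(a u ≤ a v ∧ b v ≤ b u ∧ ¬(a u = a v ∧ b u = b v))

/-- A proper CMPTG: a central MPT representation in which no interval properly
contains another. -/
def IsPCMPTG (G : SimpleGraph V) : Prop :=
  ∃ a b : V → ℝ, IsMPTRep G a b (fun u => (a u + b u) / 2) ∧
    ∀ u v : V, u ≠ v → ¬(a u ≤ a v ∧ b v ≤ b u ∧ ¬(a u = a v ∧ b u = b v))

/-- Greedy construction of unit-distance positions from an umbrella ordering. -/
theorem exists_unit_positions (G : SimpleGraph V) (f : V → ℝ)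
    (h1 : ∀ u v w, u ≠ v → f u ≤ f v → f v ≤ f w → G.Adj u w → G.Adj u v)
    (h2 : ∀ u v w, v ≠ w → f u ≤ f v → f v ≤ f w → G.Adj u w → G.Adj v w)
    (s : Finset V) :
    ∃ x : V → ℝ, ∀ u ∈ s, ∀ v ∈ s, u ≠ v →
      x u ≠ x v ∧ (x u < x v → f u ≤ f v) ∧
      (G.Adj u v → x u < x v + 1) ∧
      (¬ G.Adj u v → x u < x v → x u + 1 < x v) := by
  classical
  induction s using Finset.induction_on_max_value f with
  | empty => exact ⟨fun _ => 0, by simp⟩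
  | insert n s hn hmax ih =>
    obtain ⟨x, hx⟩ := ih
    obtain ⟨y, hlo, hhi⟩ := Order.exists_between_finsets
      (lo := s.image x ∪ (s.filter (fun i => ¬ G.Adj i n)).image (fun i => x i + 1))
      (hi := (s.filter (fun i => G.Adj i n)).image (fun i => x i + 1)) (by
        intro l hl r hr
        simp only [Finset.mem_union, Finset.mem_image, Finset.mem_filter] at hl hr
        obtain ⟨j, ⟨hj, hjn⟩, rfl⟩ := hr
        rcases hl with ⟨i, hi, rfl⟩ | ⟨i, ⟨hi, hin⟩, rfl⟩
        · by_contra hcon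
          push Not at hcon
          have hlt : x j < x i := by linarith
          have hne : j ≠ i := by rintro rfl; exact lt_irrefl _ hlt
          obtain ⟨-, hf, -, -⟩ := hx j hj i hi hne
          have hadj := h1 j i n hne (hf hlt) (hmax i hi) hjn
          have := (hx i hi j hj hne.symm).2.2.1 hadj.symm
          linarith
        · by_contra hcon
          push Not at hcon
          have hne : j ≠ i := by rintro rfl; exact hin hjn
          obtain ⟨hxne, hf, -, -⟩ := hx j hj i hi hne
          have hlt : x j < x i := lt_of_le_of_ne (by linarith) hxne
          exact hin (h2 j i n (by rintro rfl; exact hn hi) (hf hlt) (hmax i hi) hjn))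
    have ylo : ∀ i ∈ s, x i < y := fun i hi => hlo _ (by
      simp only [Finset.mem_union, Finset.mem_image]; exact Or.inl ⟨i, hi, rfl⟩)
    have ylo' : ∀ i ∈ s, ¬ G.Adj i n → x i + 1 < y := fun i hi h => hlo _ (by
      simp only [Finset.mem_union, Finset.mem_image, Finset.mem_filter]
      exact Or.inr ⟨i, ⟨hi, h⟩, rfl⟩)
    have yhi : ∀ i ∈ s, G.Adj i n → y < x i + 1 := fun i hi h => hhi _ (by
      simp only [Finset.mem_image, Finset.mem_filter]
      exact ⟨i, ⟨hi, h⟩, rfl⟩)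
    have hs : ∀ i ∈ s, Function.update x n y i = x i := fun i hi =>
      Function.update_of_ne (by rintro rfl; exact hn hi) _ _
    have hnn : Function.update x n y n = y := Function.update_self _ _ _
    refine ⟨Function.update x n y, ?_⟩
    intro u hu v hv huv
    rcases Finset.mem_insert.1 hu with rfl | hu' <;> rcases Finset.mem_insert.1 hv with rfl | hv'
    · exact absurd rfl huv
    · rw [hnn, hs v hv']
      have := ylo v hv'
      exact ⟨this.ne', fun h => absurd h this.not_gt, fun h => yhi v hv' h.symm,
        fun _ h => absurd h this.not_gt⟩
    · rw [hnn, hs u hu']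
      have := ylo u hu'
      exact ⟨this.ne, fun _ => hmax u hu', fun _ => by linarith, fun h _ => ylo' u hu' h⟩
    · rw [hs u hu', hs v hv']
      exact hx u hu' v hv' huv

/-- An umbrella ordering of a finite graph yields a unit-distance model. -/
theorem exists_unit_model [Fintype V] (G : SimpleGraph V) (f : V → ℝ)
    (h1 : ∀ u v w, u ≠ v → f u ≤ f v → f v ≤ f w → G.Adj u w → G.Adj u v)
    (h2 : ∀ u v w, v ≠ w → f u ≤ f v → f v ≤ f w → G.Adj u w → G.Adj v w) :
    ∃ x : V → ℝ, ∀ u v, u ≠ v → (G.Adj u v ↔ x u ≤ x v + 1 ∧ x v ≤ x u + 1) := by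
  obtain ⟨x, hx⟩ := exists_unit_positions G f h1 h2 Finset.univ
  refine ⟨x, fun u v huv => ?_⟩
  obtain ⟨hne, -, ha, hb⟩ := hx u (Finset.mem_univ _) v (Finset.mem_univ _) huv
  obtain ⟨-, -, ha', hb'⟩ := hx v (Finset.mem_univ _) u (Finset.mem_univ _) huv.symm
  constructor
  · intro h
    exact ⟨(ha h).le, (ha' h.symm).le⟩
  · rintro ⟨h, h'⟩
    by_contra hn
    rcases lt_or_gt_of_ne hne with hlt | hlt
    · have := hb hn hlt
      linarith
    · have := hb' (fun k => hn k.symm) hlt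
      linarith

/-- A finite simple graph is a proper central-max-point tolerance graph iff it is a
proper interval graph. -/
theorem pcmptg_iff_properInterval [Fintype V] (G : SimpleGraph V) :
    IsPCMPTG G ↔ IsProperIntervalGraph G := by
  constructor
  · rintro ⟨a, b, ⟨hab, -, hadj⟩, hp⟩
    have hmono : ∀ u v, a u ≤ a v → b u ≤ b v := by
      intro u v h
      by_contra hcon
      push Not at hcon
      exact hp u v (by rintro rfl; exact lt_irrefl _ hcon) ⟨h, hcon.le, fun k => hcon.ne k.2.symm⟩
    simp only [Set.mem_inter_iff, Set.mem_Icc] at hadj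
    obtain ⟨x, hx⟩ := exists_unit_model G a
      (by
        intro u v w huv h h' hA
        by_cases huw : u = w
        · subst huw; exact absurd hA (G.irrefl)
        rw [hadj u w huw] at hA
        rw [hadj u v huv]
        have := hmono u v h
        have := hmono v w h'
        have := hab u
        have := hab v
        have := hab w
        obtain ⟨⟨⟨_, _⟩, _, _⟩, ⟨_, _⟩, _, _⟩ := hA
        refine ⟨⟨⟨?_, ?_⟩, ?_, ?_⟩, ⟨?_, ?_⟩, ?_, ?_⟩ <;> linarith)
      (by
        intro u v w hvw h h' hA
        by_cases huw : u = w
        · subst huw; exact absurd hA (G.irrefl)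
        rw [hadj u w huw] at hA
        rw [hadj v w hvw]
        have := hmono u v h
        have := hmono v w h'
        have := hab u
        have := hab v
        have := hab w
        obtain ⟨⟨⟨_, _⟩, _, _⟩, ⟨_, _⟩, _, _⟩ := hA
        refine ⟨⟨⟨?_, ?_⟩, ?_, ?_⟩, ⟨?_, ?_⟩, ?_, ?_⟩ <;> linarith)
    refine ⟨x, fun u => x u + 1, fun u => by linarith, ?_, ?_⟩
    · intro u v huv
      rw [hx u v huv]
      constructor
      · rintro ⟨h, h'⟩
        rcases le_total (x u) (x v) with k | k
        · exact ⟨x v, ⟨k, h'⟩, le_rfl, by linarith⟩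
        · exact ⟨x u, ⟨le_rfl, by linarith⟩, k, h⟩
      · rintro ⟨t, ⟨_, _⟩, _, _⟩
        constructor <;> linarith
    · rintro u v - ⟨h, h', hn⟩
      exact hn ⟨by linarith, by linarith⟩
  · rintro ⟨a, b, hab, hadj, hp⟩
    have hmono : ∀ u v, a u ≤ a v → b u ≤ b v := by
      intro u v h
      by_contra hcon
      push Not at hcon
      exact hp u v (by rintro rfl; exact lt_irrefl _ hcon) ⟨h, hcon.le, fun k => hcon.ne k.2.symm⟩
    obtain ⟨x, hx⟩ := exists_unit_model G a
      (by
        intro u v w huv h h' hA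
        by_cases huw : u = w
        · subst huw; exact absurd hA (G.irrefl)
        rw [hadj u w huw] at hA
        rw [hadj u v huv]
        obtain ⟨t, ⟨_, _⟩, _, _⟩ := hA
        exact ⟨a v, ⟨h, by linarith⟩, le_rfl, hab v⟩)
      (by
        intro u v w hvw h h' hA
        by_cases huw : u = w
        · subst huw; exact absurd hA (G.irrefl)
        rw [hadj u w huw] at hA
        rw [hadj v w hvw]
        have := hmono u v h
        obtain ⟨t, ⟨_, _⟩, _, _⟩ := hA
        exact ⟨a w, ⟨h', by linarith⟩, le_rfl, hab w⟩)
    refine ⟨fun u => x u - 1, fun u => x u + 1, ⟨fun u => by linarith, fun u => ?_, ?_⟩, ?_⟩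
    · constructor <;> linarith
    · intro u v huv
      rw [hx u v huv]
      simp only [Set.mem_inter_iff, Set.mem_Icc]
      constructor
      · rintro ⟨h, h'⟩
        refine ⟨⟨⟨?_, ?_⟩, ?_, ?_⟩, ⟨?_, ?_⟩, ?_, ?_⟩ <;> linarith
      · rintro ⟨⟨⟨_, _⟩, _, _⟩, ⟨_, _⟩, _, _⟩
        constructor <;> linarith
    · rintro u v - ⟨h, h', hn⟩
      exact hn ⟨by linarith, by linarith⟩
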